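/- arXiv:2010.15650 — 2 statements merged into one kernel-verified Lean document; each statement's English description precedes it below -/
import Mathlib

section
/- Let G be a finite connected simple graph and c₀ an initial configuration from which chip-firing terminates. For every vertex k and every 1 ≤ j ≤ N(k), the configuration reachable from c₀ in which the only vertex ready to fire is k and exactly j−1 firings at k have occurred in reaching it is unique: if two reachable configurations both have k as their only vertex ready to fire, both reached after exactly j−1 firings at k, then they are equal. -/
/-!  Chip-firing on a finite simple graph. -/

/-- One chip-firing move at vertex `k`: `k` loses `deg k` chips and each of its
neighbors gains one chip. -/
def gfire {V : Type*} [Fintype V] [DecidableEq V] (G : SimpleGraph V) [DecidableRel G.Adj]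
    (c : V → ℕ) (k : V) : V → ℕ :=
  fun v => if v = k then c k - G.degree k else if G.Adj k v then c v + 1 else c v

/-- Apply a list of firing moves in order. -/
def gapply {V : Type*} [Fintype V] [DecidableEq V] (G : SimpleGraph V) [DecidableRel G.Adj]
    (c : V → ℕ) : List V → (V → ℕ)
  | [] => c
  | k :: s => gapply G (gfire G c k) s

/-- The list of vertices `s` is a legal firing sequence from `c`: every fired vertex
has at least as many chips as its degree at the moment it is fired. -/
def GLegal {V : Type*} [Fintype V] [DecidableEq V] (G : SimpleGraph V) [DecidableRel G.Adj]
    (c : V → ℕ) : List V → Prop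
  | [] => True
  | k :: s => G.degree k ≤ c k ∧ GLegal G (gfire G c k) s

/-- `c₂` is reachable from `c₁` by a sequence of firing moves. -/
def GReachable {V : Type*} [Fintype V] [DecidableEq V] (G : SimpleGraph V) [DecidableRel G.Adj]
    (c₁ c₂ : V → ℕ) : Prop :=
  ∃ s, GLegal G c₁ s ∧ gapply G c₁ s = c₂

/-- Vertex `k` is ready to fire in `c`. -/
def GReady {V : Type*} [Fintype V] [DecidableEq V] (G : SimpleGraph V) [DecidableRel G.Adj]
    (c : V → ℕ) (k : V) : Prop := G.degree k ≤ c k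

/-- No vertex is ready to fire in `c`. -/
def GStable {V : Type*} [Fintype V] [DecidableEq V] (G : SimpleGraph V) [DecidableRel G.Adj]
    (c : V → ℕ) : Prop := ∀ k, c k < G.degree k

/-- Some legal firing sequence from `c₀` performs the `j'`-th firing at `k'`
strictly before the `j`-th firing at `k`: there is a legal sequence with a prefix `t`
containing exactly `j' - 1` firings at `k'` and fewer than `j` firings at `k`,
immediately followed by a firing at `k'`. -/
def GFiresBefore {V : Type*} [Fintype V] [DecidableEq V] (G : SimpleGraph V) [DecidableRel G.Adj]
    (c₀ : V → ℕ) (k' : V) (j' : ℕ) (k : V) (j : ℕ) : Prop :=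
  ∃ t u : List V, GLegal G c₀ (t ++ k' :: u) ∧ t.count k' = j' - 1 ∧ t.count k < j

/-- The move-poset order: move `p = (k, j)` (the `j`-th firing at `k`) satisfies `p ≥ q`
iff `p = q` or no legal firing sequence from `c₀` performs move `q` strictly before `p`. -/
def GMoveGE {V : Type*} [Fintype V] [DecidableEq V] (G : SimpleGraph V) [DecidableRel G.Adj]
    (c₀ : V → ℕ) (p q : V × ℕ) : Prop :=
  p = q ∨ ¬ GFiresBefore G c₀ q.1 q.2 p.1 p.2

section ChipFiring

variable {V : Type*} [Fintype V] [DecidableEq V] (G : SimpleGraph V) [DecidableRel G.Adj]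

theorem gLegal_append_singleton (c : V → ℕ) (s : List V) (v : V) :
    GLegal G c (s ++ [v]) ↔ GLegal G c s ∧ G.degree v ≤ gapply G c s v := by
  induction s generalizing c with
  | nil => simp [GLegal, gapply]
  | cons k s ih => simp [GLegal, gapply, ih, and_assoc]

theorem gfire_add_degree {c : V → ℕ} {k : V} (hk : G.degree k ≤ c k) (v : V) :
    gfire G c k v + G.degree v * [k].count v =
      c v + ∑ u ∈ G.neighborFinset v, [k].count u := by
  have hsum : ∑ u ∈ G.neighborFinset v, [k].count u = if G.Adj k v then 1 else 0 := by
    simp [List.count_singleton, G.adj_comm k v]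
  rw [hsum]
  by_cases hv : v = k
  · subst hv
    simp [gfire, hk]
  · have hv' : k ≠ v := Ne.symm hv
    by_cases ha : G.Adj k v <;> simp [gfire, hv, hv', ha]

/-- Chip balance at a vertex along a legal firing sequence. -/
theorem gapply_add_degree_mul_count {c : V → ℕ} {s : List V} (hs : GLegal G c s) (v : V) :
    gapply G c s v + G.degree v * s.count v =
      c v + ∑ u ∈ G.neighborFinset v, s.count u := by
  induction s generalizing c with
  | nil => simp [gapply]
  | cons k s ih =>
    have hfire := gfire_add_degree G hs.1 v
    have hrest := ih hs.2
    have hcount (u : V) : (k :: s).count u = [k].count u + s.count u := by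
      rw [← List.count_append, List.singleton_append]
    simp only [gapply, hcount, Finset.sum_add_distrib, mul_add]
    omega

/-- Least action principle: a legal sequence `s` fires no vertex more often than `t` does, if this
holds for the vertices that are still ready after `t`. -/
theorem GLegal.count_le_count {c : V → ℕ} {s t : List V} (hs : GLegal G c s) (ht : GLegal G c t)
    (h : ∀ v, GReady G (gapply G c t) v → s.count v ≤ t.count v) (v : V) :
    s.count v ≤ t.count v := by
  induction s using List.reverseRecOn generalizing v with
  | nil => simp
  | append_singleton p w ih =>
    obtain ⟨hp, hw⟩ := (gLegal_append_singleton G c p w).1 hs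
    have hle : ∀ u, p.count u ≤ t.count u :=
      ih hp fun u hu => le_trans (by simp [List.count_append]) (h u hu)
    by_cases hvw : v = w
    · subst hvw
      by_contra! hlt
      have hready : ¬ GReady G (gapply G c t) v := fun hr => hlt.not_ge (h v hr)
      have heq : p.count v = t.count v := by
        have := hle v
        simp [List.count_append] at hlt
        omega
      have hbp := gapply_add_degree_mul_count G hp v
      have hbt := gapply_add_degree_mul_count G ht v
      have hsum := Finset.sum_le_sum fun u (_ : u ∈ G.neighborFinset v) => hle u
      rw [heq] at hbp
      unfold GReady at hready
      omega
    · simpa [List.count_append, List.count_singleton, Ne.symm hvw] using hle v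

theorem gapply_eq_of_count_eq {c : V → ℕ} {s t : List V} (hs : GLegal G c s) (ht : GLegal G c t)
    (h : ∀ v, s.count v = t.count v) : gapply G c s = gapply G c t := by
  funext v
  have hbs := gapply_add_degree_mul_count G hs v
  have hbt := gapply_add_degree_mul_count G ht v
  simp only [h] at hbs
  omega

end ChipFiring

/-- The configuration reachable from `c₀` in which the only vertex
ready to fire is `k` and exactly `j - 1` firings at `k` have occurred in reaching it
is unique. -/
theorem config_unique_available_move_unique
    {V : Type*} [Fintype V] [DecidableEq V] (G : SimpleGraph V) [DecidableRel G.Adj]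
    (hG : G.Connected) (c₀ : V → ℕ)
    (hterm : ∃ s, GLegal G c₀ s ∧ GStable G (gapply G c₀ s))
    (N : V → ℕ)
    (hN : ∀ s, GLegal G c₀ s → GStable G (gapply G c₀ s) → ∀ k, s.count k = N k)
    (k : V) (j : ℕ) (hj1 : 1 ≤ j) (hj2 : j ≤ N k)
    (c₁ c₂ : V → ℕ) (s₁ s₂ : List V)
    (hs₁ : GLegal G c₀ s₁) (hc₁ : gapply G c₀ s₁ = c₁) (hcount₁ : s₁.count k = j - 1)
    (hready₁ : ∀ v, GReady G c₁ v ↔ v = k)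
    (hs₂ : GLegal G c₀ s₂) (hc₂ : gapply G c₀ s₂ = c₂) (hcount₂ : s₂.count k = j - 1)
    (hready₂ : ∀ v, GReady G c₂ v ↔ v = k) :
    c₁ = c₂ := by
  subst hc₁ hc₂
  refine gapply_eq_of_count_eq G hs₁ hs₂ fun v => le_antisymm ?_ ?_
  · refine hs₁.count_le_count G hs₂ (fun u hu => ?_) v
    rw [(hready₂ u).1 hu, hcount₁, hcount₂]
  · refine hs₂.count_le_count G hs₁ (fun u hu => ?_) v
    rw [(hready₁ u).1 hu, hcount₁, hcount₂]
end

section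
/- Let G be a finite connected simple graph and c₀ an initial configuration from which chip-firing terminates. Let k^j and k'^{j'} be two distinct moves such that k^j must occur before k'^{j'}, i.e., no firing sequence from c₀ performs the j'-th firing at k' strictly before the j-th firing at k. Then c(k'^{j'}) is reachable from c(k^j) by a sequence of firing moves. -/
section ChipFiring

variable {V : Type*} [Fintype V] [DecidableEq V] (G : SimpleGraph V) [DecidableRel G.Adj]

theorem gapply_append (c : V → ℕ) (s t : List V) :
    gapply G c (s ++ t) = gapply G (gapply G c s) t := by
  induction s generalizing c with
  | nil => rfl
  | cons a s ih => exact ih _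

theorem gLegal_append (c : V → ℕ) (s t : List V) :
    GLegal G c (s ++ t) ↔ GLegal G c s ∧ GLegal G (gapply G c s) t := by
  induction s generalizing c with
  | nil => simp [GLegal, gapply]
  | cons a s ih => simp [GLegal, gapply, ih, and_assoc]

variable {G}

theorem gfire_add {c : V → ℕ} {k : V} (h : G.degree k ≤ c k) (v : V) :
    gfire G c k v + G.degree v * [k].count v = c v + ∑ u ∈ G.neighborFinset v, [k].count u := by
  have hsum : ∑ u ∈ G.neighborFinset v, [k].count u = if G.Adj v k then 1 else 0 := by
    simp [List.count_singleton, Finset.sum_ite_eq]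
  rw [hsum, gfire]
  by_cases hv : v = k
  · subst hv
    simp only [if_true, List.count_singleton_self, mul_one, SimpleGraph.irrefl, if_false]
    omega
  · simp only [hv, if_false, G.adj_comm k v, List.count_singleton, beq_iff_eq, Ne.symm hv]
    split_ifs <;> omega

/-- Conservation of chips at `v` along a legal firing sequence. -/
theorem gapply_add {c : V → ℕ} {s : List V} (h : GLegal G c s) (v : V) :
    gapply G c s v + G.degree v * s.count v = c v + ∑ u ∈ G.neighborFinset v, s.count u := by
  induction s generalizing c with
  | nil => simp [gapply]
  | cons a s ih =>
    have h₁ := ih h.2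
    have h₂ := gfire_add h.1 v
    have hcons : ∀ u, (a :: s).count u = [a].count u + s.count u := fun u =>
      List.count_append (l₁ := [a])
    simp only [gapply, hcons, Finset.sum_add_distrib, mul_add]
    omega

theorem gapply_eq_of_perm {c : V → ℕ} {s t : List V} (hs : GLegal G c s) (ht : GLegal G c t)
    (h : s.Perm t) : gapply G c s = gapply G c t := by
  funext v
  have h₁ := gapply_add hs v
  have h₂ := gapply_add ht v
  simp only [h.count_eq] at h₁
  omega

theorem gReady_gapply_of_count_le {c : V → ℕ} {r t : List V} {v : V} (hr : GLegal G c r)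
    (ht : GLegal G c t) (hle : ∀ w, t.count w ≤ r.count w) (hv : t.count v = r.count v)
    (h : GReady G (gapply G c t) v) : GReady G (gapply G c r) v := by
  have h₁ := gapply_add ht v
  have h₂ := gapply_add hr v
  have h₃ : ∑ u ∈ G.neighborFinset v, t.count u ≤ ∑ u ∈ G.neighborFinset v, r.count u :=
    Finset.sum_le_sum fun u _ => hle u
  rw [hv] at h₁
  unfold GReady at *
  omega

theorem exists_first_count_excess {s r : List V} (h : ¬ ∀ w, s.count w ≤ r.count w) :
    ∃ t v u, s = t ++ v :: u ∧ (∀ w, t.count w ≤ r.count w) ∧ t.count v = r.count v := by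
  induction s using List.reverseRecOn with
  | nil => simp at h
  | append_singleton s a ih =>
    by_cases hs : ∀ w, s.count w ≤ r.count w
    · refine ⟨s, a, [], rfl, hs, (hs a).antisymm ?_⟩
      by_contra! hlt
      refine h fun w => ?_
      have hw := hs w
      rw [List.count_append, List.count_singleton]
      by_cases haw : a = w
      · subst haw
        simp only [beq_self_eq_true, if_true]
        omega
      · simpa [haw] using hw
    · obtain ⟨t, v, u, rfl, ht, hv⟩ := ih hs
      exact ⟨t, v, u ++ [a], by simp, ht, hv⟩

/-- Exchange property: a legal sequence not dominated by `r` has a first excess firing, which is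
available after `r`. -/
theorem exists_gReady_of_not_count_le {c : V → ℕ} {s r : List V} (hs : GLegal G c s)
    (hr : GLegal G c r) (h : ¬ ∀ w, s.count w ≤ r.count w) :
    ∃ t v u, s = t ++ v :: u ∧ t.count v = r.count v ∧ GReady G (gapply G c r) v := by
  obtain ⟨t, v, u, rfl, ht, hv⟩ := exists_first_count_excess h
  obtain ⟨hlt, hvu⟩ := (gLegal_append G c t _).1 hs
  exact ⟨t, v, u, rfl, hv, gReady_gapply_of_count_le hr hlt ht hv hvu.1⟩

theorem gReachable_of_count_le {c : V → ℕ} {r s : List V} (hr : GLegal G c r)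
    (hs : GLegal G c s) (hle : ∀ w, r.count w ≤ s.count w) :
    GReachable G (gapply G c r) (gapply G c s) := by
  have hlen := (List.subperm_ext_iff.2 fun w _ => hle w).length_le
  obtain ⟨n, hn⟩ := Nat.exists_eq_add_of_le hlen
  clear hlen
  induction n generalizing r with
  | zero =>
    have hp := (List.subperm_ext_iff.2 fun w _ => hle w).perm_of_length_le (by omega)
    exact ⟨[], trivial, gapply_eq_of_perm hr hs hp⟩
  | succ n ih =>
    have hnot : ¬ ∀ w, s.count w ≤ r.count w := fun h => by
      have := (List.subperm_ext_iff.2 fun w _ => h w).length_le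
      omega
    obtain ⟨t, v, u, rfl, hv, hready⟩ := exists_gReady_of_not_count_le hs hr hnot
    have hrv : GLegal G c (r ++ [v]) := (gLegal_append G c r [v]).2 ⟨hr, hready, trivial⟩
    obtain ⟨q, hq, hqs⟩ := ih hrv (fun w => by
      have hw := hle w
      by_cases hvw : v = w
      · subst hvw
        rw [List.count_append, List.count_singleton_self, List.count_append, List.count_cons_self]
        omega
      · simpa [hvw] using hw) (by simp only [List.length_append, List.length_singleton] at *; omega)
    rw [gapply_append] at hq hqs
    exact ⟨v :: q, ⟨hready, hq⟩, hqs⟩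

end ChipFiring

/-- If move `k^j` must occur before move `k'^{j'}` (no firing sequence
from `c₀` performs the `j'`-th firing at `k'` strictly before the `j`-th firing at `k`),
then `c(k'^{j'})` is reachable from `c(k^j)`. -/
theorem reachable_of_must_occur_before
    {V : Type*} [Fintype V] [DecidableEq V] (G : SimpleGraph V) [DecidableRel G.Adj]
    (hG : G.Connected) (c₀ : V → ℕ)
    (hterm : ∃ s, GLegal G c₀ s ∧ GStable G (gapply G c₀ s))
    (N : V → ℕ)
    (hN : ∀ s, GLegal G c₀ s → GStable G (gapply G c₀ s) → ∀ k, s.count k = N k)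
    (k k' : V) (j j' : ℕ)
    (hj1 : 1 ≤ j) (hj2 : j ≤ N k) (hj'1 : 1 ≤ j') (hj'2 : j' ≤ N k')
    (hne : (k, j) ≠ (k', j'))
    (hbefore : ¬ GFiresBefore G c₀ k' j' k j)
    -- `c₁ = c(k^j)` : the configuration in which `k^j` is the only available move
    (c₁ : V → ℕ) (s₁ : List V)
    (hs₁ : GLegal G c₀ s₁) (hc₁ : gapply G c₀ s₁ = c₁) (hcount₁ : s₁.count k = j - 1)
    (hready₁ : ∀ v, GReady G c₁ v ↔ v = k)
    -- `c₂ = c(k'^{j'})` : the configuration in which `k'^{j'}` is the only available move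
    (c₂ : V → ℕ) (s₂ : List V)
    (hs₂ : GLegal G c₀ s₂) (hc₂ : gapply G c₀ s₂ = c₂) (hcount₂ : s₂.count k' = j' - 1)
    (hready₂ : ∀ v, GReady G c₂ v ↔ v = k') :
    GReachable G c₁ c₂ := by
  subst hc₁ hc₂
  refine gReachable_of_count_le hs₁ hs₂ ?_
  by_contra h
  obtain ⟨t, v, u, rfl, hv, hready⟩ := exists_gReady_of_not_count_le hs₁ hs₂ h
  obtain rfl := (hready₂ v).1 hready
  refine hbefore ⟨t, u, hs₁, hv.trans hcount₂, ?_⟩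
  rw [List.count_append] at hcount₁
  omega
end
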